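/- arXiv:2208.09768 — 2 statements merged into one kernel-verified Lean document; each statement's English description precedes it below -/
import Mathlib

section
/- Let 1 ≤ d ≤ m be integers, λ := d/m, and let p be a monic real polynomial of degree d all of whose roots are nonnegative reals, with largest root R. Define, for real x > √R, G(x) := x·p′(x²)/(d·p(x²)) and H(x) := G(x)·(λ·G(x) + (1−λ)/x). Then H is strictly decreasing on the open interval (√R, ∞) and maps (√R, ∞) bijectively onto (0, ∞). -/
open Polynomial Set

/-- The Cauchy transform `G(x) = x·p′(x²)/(d·p(x²))` of the symmetrization of `p`. -/
noncomputable def Gfun (d : ℕ) (p : Polynomial ℝ) : ℝ → ℝ := fun x =>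
  x * (Polynomial.derivative p).eval (x ^ 2) / ((d : ℝ) * p.eval (x ^ 2))

/-- The `λ`-rectangular Cauchy transform `H(x) = G(x)·(λ·G(x) + (1−λ)/x)` with `λ = d/m`. -/
noncomputable def Hfun (m d : ℕ) (p : Polynomial ℝ) : ℝ → ℝ := fun x =>
  Gfun d p x * (((d : ℝ) / (m : ℝ)) * Gfun d p x + (1 - (d : ℝ) / (m : ℝ)) / x)

theorem lt_sq_of_sqrt_lt {r R x : ℝ} (hr : r ≤ R) (hx : √R < x) : r < x ^ 2 :=
  hr.trans_lt ((Real.sqrt_lt' ((Real.sqrt_nonneg R).trans_lt hx)).1 hx)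

theorem div_sq_sub_lt_div_sq_sub {r x y : ℝ} (hr : 0 ≤ r) (hx0 : 0 < x) (hx : r < x ^ 2)
    (hxy : x < y) : y / (y ^ 2 - r) < x / (x ^ 2 - r) := by
  have hy : x ^ 2 < y ^ 2 := by gcongr
  rw [div_lt_div_iff₀ (by linarith) (by linarith)]
  have : 0 < (y - x) * (x * y + r) := by
    have : 0 < x * y := mul_pos hx0 (hx0.trans hxy)
    exact mul_pos (by linarith) (by linarith)
  linarith

/-- `x ↦ x / (x² - R)` maps `(√R, ∞)` onto `(0, ∞)`. -/
theorem exists_div_sq_sub_eq {R t : ℝ} (hR : 0 ≤ R) (ht : 0 < t) :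
    ∃ x, √R < x ∧ x / (x ^ 2 - R) = t := by
  have hnn : 0 ≤ (1 / t) ^ 2 + 4 * R := by positivity
  obtain ⟨x, hx⟩ : ∃ x, x = (1 / t + √((1 / t) ^ 2 + 4 * R)) / 2 := ⟨_, rfl⟩
  have hx0 : 0 < x := by rw [hx]; positivity
  have key : x ^ 2 - R = x / t := by
    have hs := Real.sq_sqrt hnn
    have hsub : √((1 / t) ^ 2 + 4 * R) = 2 * x - 1 / t := by rw [hx]; ring
    rw [hsub] at hs
    have : x / t = x * (1 / t) := by ring
    rw [this]
    linarith
  refine ⟨x, ?_, ?_⟩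
  · rw [Real.sqrt_lt' hx0]
    have : 0 < x / t := by positivity
    linarith
  · rw [key]
    field_simp

theorem Gfun_eq_sum {d : ℕ} {p : ℝ[X]} (hp : p.Splits) {x : ℝ} (hx : p.eval (x ^ 2) ≠ 0) :
    Gfun d p x = (p.roots.map fun r => x / (x ^ 2 - r)).sum / d := by
  have h := hp.eval_derivative_div_eval_of_ne_zero hx
  have hsum : (p.roots.map fun r => x / (x ^ 2 - r)).sum =
      x * (p.roots.map fun r => 1 / (x ^ 2 - r)).sum := by
    rw [← Multiset.sum_map_mul_left]
    simp [div_eq_mul_inv]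
  rw [hsum, ← h, Gfun]
  ring

theorem eval_sq_ne_zero_of_sqrt_lt {p : ℝ[X]} (hp : p ≠ 0) {R x : ℝ}
    (hRmax : ∀ r ∈ p.roots, r ≤ R) (hx : √R < x) : p.eval (x ^ 2) ≠ 0 := fun h =>
  (lt_sq_of_sqrt_lt (hRmax _ ((mem_roots hp).2 h)) hx).false

theorem continuousOn_Gfun {d : ℕ} {p : ℝ[X]} {s : Set ℝ} (hd : d ≠ 0)
    (hs : ∀ x ∈ s, p.eval (x ^ 2) ≠ 0) : ContinuousOn (Gfun d p) s := by
  unfold Gfun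
  refine ContinuousOn.div (by fun_prop) (by fun_prop) fun x hx => ?_
  exact mul_ne_zero (Nat.cast_ne_zero.2 hd) (hs x hx)

theorem strictAntiOn_Gfun {d : ℕ} {p : ℝ[X]} (hd : d ≠ 0) (hp : p.Splits)
    (hnonneg : ∀ r ∈ p.roots, 0 ≤ r) {R : ℝ} (hR : R ∈ p.roots)
    (hRmax : ∀ r ∈ p.roots, r ≤ R) : StrictAntiOn (Gfun d p) (Ioi √R) := by
  intro x hx y hy hxy
  have hp0 := ne_zero_of_mem_roots hR
  rw [Gfun_eq_sum hp (eval_sq_ne_zero_of_sqrt_lt hp0 hRmax hx),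
    Gfun_eq_sum hp (eval_sq_ne_zero_of_sqrt_lt hp0 hRmax hy)]
  refine div_lt_div_of_pos_right ?_ (by positivity)
  refine Multiset.sum_lt_sum_of_nonempty (fun h => by simp [h] at hR) fun r hr => ?_
  exact div_sq_sub_lt_div_sq_sub (hnonneg r hr) ((Real.sqrt_nonneg R).trans_lt hx)
    (lt_sq_of_sqrt_lt (hRmax r hr) hx) hxy

theorem div_le_Gfun {d : ℕ} {p : ℝ[X]} (hp : p.Splits) {R x : ℝ} (hR : R ∈ p.roots)
    (hRmax : ∀ r ∈ p.roots, r ≤ R) (hx : √R < x) : x / (x ^ 2 - R) / d ≤ Gfun d p x := by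
  rw [Gfun_eq_sum hp (eval_sq_ne_zero_of_sqrt_lt (ne_zero_of_mem_roots hR) hRmax hx)]
  gcongr
  refine Multiset.single_le_sum ?_ _ (Multiset.mem_map_of_mem (fun r => x / (x ^ 2 - r)) hR)
  simp only [Multiset.mem_map, forall_exists_index, and_imp, forall_apply_eq_imp_iff₂]
  intro r hr
  exact div_nonneg ((Real.sqrt_nonneg R).trans hx.le)
    (sub_nonneg.2 (lt_sq_of_sqrt_lt (hRmax r hr) hx).le)

theorem Gfun_le_div {d : ℕ} {p : ℝ[X]} (hp : p.Splits) (hcard : p.roots.card = d) {R x : ℝ}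
    (hR : R ∈ p.roots) (hRmax : ∀ r ∈ p.roots, r ≤ R) (hx : √R < x) :
    Gfun d p x ≤ x / (x ^ 2 - R) := by
  rw [Gfun_eq_sum hp (eval_sq_ne_zero_of_sqrt_lt (ne_zero_of_mem_roots hR) hRmax hx)]
  have hd : (0 : ℝ) < d := by
    rw [← hcard]
    exact_mod_cast Multiset.card_pos_iff_exists_mem.2 ⟨R, hR⟩
  have hsum : (p.roots.map fun r => x / (x ^ 2 - r)).sum ≤
      (p.roots.map fun r => x / (x ^ 2 - r)).card • (x / (x ^ 2 - R)) := by
    refine Multiset.sum_le_card_nsmul _ _ ?_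
    simp only [Multiset.mem_map, forall_exists_index, and_imp, forall_apply_eq_imp_iff₂]
    intro r hr
    have := hRmax r hr
    have := lt_sq_of_sqrt_lt le_rfl hx
    exact div_le_div_of_nonneg_left ((Real.sqrt_nonneg R).trans hx.le) (by linarith)
      (by linarith)
  rw [Multiset.card_map, hcard, nsmul_eq_mul] at hsum
  rw [div_le_iff₀ hd]
  linarith

/-- For a monic real `p` of degree `d` with all roots nonnegative reals and largest root
`R`, the rectangular Cauchy transform `H` is strictly decreasing on `(√R, ∞)` and maps
`(√R, ∞)` bijectively onto `(0, ∞)`. -/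
theorem stmt8 (m d : ℕ) (hd : 1 ≤ d) (hdm : d ≤ m)
    (p : Polynomial ℝ) (hmonic : p.Monic) (hdeg : p.natDegree = d)
    (hsplit : p.roots.card = d) (hnonneg : ∀ r ∈ p.roots, 0 ≤ r)
    (R : ℝ) (hR : R ∈ p.roots) (hRmax : ∀ r ∈ p.roots, r ≤ R) :
    StrictAntiOn (Hfun m d p) (Set.Ioi (Real.sqrt R)) ∧
      Set.BijOn (Hfun m d p) (Set.Ioi (Real.sqrt R)) (Set.Ioi (0 : ℝ)) := by
  have hp : p.Splits := splits_iff_card_roots.2 (hsplit.trans hdeg.symm)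
  have hd0 : (0 : ℝ) < d := by exact_mod_cast hd
  have hm0 : (0 : ℝ) < m := by exact_mod_cast hd.trans hdm
  have hR0 : 0 ≤ R := hnonneg R hR
  have hpos : ∀ x ∈ Ioi √R, 0 < x := fun x hx => (Real.sqrt_nonneg R).trans_lt hx
  have hG := strictAntiOn_Gfun (Nat.one_le_iff_ne_zero.1 hd) hp hnonneg hR hRmax
  have hGcont : ContinuousOn (Gfun d p) (Ioi √R) :=
    continuousOn_Gfun (Nat.one_le_iff_ne_zero.1 hd) fun x hx =>
      eval_sq_ne_zero_of_sqrt_lt hmonic.ne_zero hRmax hx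
  have hupos : ∀ x ∈ Ioi √R, 0 < x / (x ^ 2 - R) := fun x hx =>
    div_pos (hpos x hx) (sub_pos.2 (lt_sq_of_sqrt_lt le_rfl hx))
  have hGpos : ∀ x ∈ Ioi √R, 0 < Gfun d p x := fun x hx =>
    (div_pos (hupos x hx) hd0).trans_le (div_le_Gfun hp hR hRmax hx)
  have hl0 : (0 : ℝ) < d / m := div_pos hd0 hm0
  have hl1 : (0 : ℝ) ≤ 1 - d / m := by
    rw [sub_nonneg, div_le_one hm0]
    exact_mod_cast hdm
  have hH : Hfun m d p = fun x => Gfun d p x * ((d / m : ℝ) * Gfun d p x + (1 - d / m) / x) := rfl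
  generalize (d : ℝ) / m = l at hl0 hl1 hH
  have hanti : StrictAntiOn (Hfun m d p) (Ioi √R) := by
    intro x hx y hy hxy
    have hx0 := hpos x hx
    have hGy := hGpos y hy
    have hlt := hG hx hy hxy
    have hy0 := hpos y hy
    simp only [hH]
    refine mul_lt_mul'' hlt ?_ hGy.le (by positivity)
    exact add_lt_add_of_lt_of_le (by gcongr) (by gcongr)
  have hHpos : ∀ x ∈ Ioi √R, 0 < Hfun m d p x := by
    intro x hx
    have := hpos x hx
    have := hGpos x hx
    simp only [hH]
    positivity
  refine ⟨hanti, hHpos, hanti.injOn, fun y hy => ?_⟩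
  have hy : 0 < y := hy
  have hHcont : ContinuousOn (Hfun m d p) (Ioi √R) := by
    rw [hH]
    refine hGcont.mul ((hGcont.const_mul l).add ?_)
    exact continuousOn_const.div continuousOn_id fun x hx => (hpos x hx).ne'
  obtain ⟨b, hb, hub⟩ := exists_div_sq_sub_eq hR0 (Real.sqrt_pos.2 hy)
  obtain ⟨a, ha, hua⟩ := exists_div_sq_sub_eq hR0 (t := d * √(y / l)) (by positivity)
  have hHb : Hfun m d p b ≤ y := by
    have hb0 := hpos b hb
    have hGb := hGpos b hb
    have hle := Gfun_le_div hp hsplit hR hRmax hb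
    have hbb : 1 / b ≤ b / (b ^ 2 - R) := by
      rw [div_le_div_iff₀ hb0 (sub_pos.2 (lt_sq_of_sqrt_lt le_rfl hb))]
      linarith
    rw [hub] at hle hbb
    simp only [hH]
    calc Gfun d p b * (l * Gfun d p b + (1 - l) / b)
        = Gfun d p b * (l * Gfun d p b + (1 - l) * (1 / b)) := by ring
      _ ≤ √y * (l * √y + (1 - l) * √y) := by gcongr
      _ = √y ^ 2 := by ring
      _ = y := Real.sq_sqrt hy.le
  have hHa : y ≤ Hfun m d p a := by
    have ha0 := hpos a ha
    have hGa := hGpos a ha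
    have hle := div_le_Gfun (d := d) hp hR hRmax ha
    rw [hua, mul_div_cancel_left₀ _ hd0.ne'] at hle
    simp only [hH]
    calc y = l * √(y / l) ^ 2 := by rw [Real.sq_sqrt (by positivity)]; field_simp
      _ ≤ l * Gfun d p a ^ 2 := by gcongr
      _ = Gfun d p a * (l * Gfun d p a + 0) := by ring
      _ ≤ Gfun d p a * (l * Gfun d p a + (1 - l) / a) := by gcongr; positivity
  exact isPreconnected_Ioi.intermediate_value hb ha hHcont ⟨hHb, hHa⟩
end

section
/- Let 1 ≤ d ≤ m be integers, λ := d/m, and let p be a monic real polynomial of degree d all of whose roots are nonnegative reals, with largest root R. Define F(x,y) := −(1/√(m·d))·log(y^{m−d}·p(x·y)) on the open set X := (√R, ∞) × (√R, ∞) (on which y^{m−d}·p(x·y) > 0). Then: (1) F is convex on X; and (2) for every z > √R, (∂F/∂x)(z,z) · (∂F/∂y)(z,z) = H(z), where G(x) := x·p′(x²)/(d·p(x²)) and H(x) := G(x)·(λ·G(x) + (1−λ)/x). -/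
open Polynomial Set

/-- The `λ`-Fuglede–Kadison potential `F(x,y) := −(1/√(m·d))·log(y^{m−d}·p(x·y))`. -/
noncomputable def Ffun (m d : ℕ) (p : Polynomial ℝ) : ℝ × ℝ → ℝ := fun z =>
  -(1 / Real.sqrt ((m : ℝ) * (d : ℝ))) * Real.log (z.2 ^ (m - d) * p.eval (z.1 * z.2))

/-- On the open quadrant beyond `√R`, the map `(x, y) ↦ log (x y - r)` is concave for
`0 ≤ r ≤ R`. -/
theorem concaveOn_log_mul_sub {r R : ℝ} (hr : 0 ≤ r) (hrR : r ≤ R) :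
    ConcaveOn ℝ (Ioi √R ×ˢ Ioi √R) fun z : ℝ × ℝ => Real.log (z.1 * z.2 - r) := by
  have hsub : ∀ {x y : ℝ}, √R < x → √R < y → 0 < y ∧ 0 < x - r / y ∧
      Real.log (x * y - r) = Real.log y + Real.log (x - r / y) := by
    intro x y hx hy
    have hs := Real.sqrt_nonneg R
    have hR2 := Real.mul_self_sqrt (hr.trans hrR)
    have hy0 : 0 < y := hs.trans_lt hy
    have h : 0 < x - r / y := by
      rw [sub_pos, div_lt_iff₀ hy0]
      nlinarith
    refine ⟨hy0, h, ?_⟩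
    rw [← Real.log_mul hy0.ne' h.ne']
    congr 1
    field_simp
  have hconv : Convex ℝ (Ioi √R ×ˢ Ioi √R) := (convex_Ioi _).prod (convex_Ioi _)
  refine ⟨hconv, ?_⟩
  rintro ⟨x, y⟩ hxy ⟨x', y'⟩ hxy' a b ha hb hab
  have hmem := hconv hxy hxy' ha hb hab
  simp only [mem_prod, mem_Ioi, Prod.fst_add, Prod.snd_add, Prod.smul_fst, Prod.smul_snd,
    smul_eq_mul] at hxy hxy' hmem ⊢
  obtain ⟨hy, hu, e⟩ := hsub hxy.1 hxy.2
  obtain ⟨hy', hu', e'⟩ := hsub hxy'.1 hxy'.2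
  obtain ⟨-, -, e''⟩ := hsub hmem.1 hmem.2
  have hlog := strictConcaveOn_log_Ioi.concaveOn.2
  have hlogy := hlog (mem_Ioi.2 hy) (mem_Ioi.2 hy') ha hb hab
  have hlogu := hlog (mem_Ioi.2 hu) (mem_Ioi.2 hu') ha hb hab
  have hinv := (convexOn_zpow (𝕜 := ℝ) (-1)).2 (mem_Ioi.2 hy) (mem_Ioi.2 hy') ha hb hab
  have hpos := (convex_Ioi (0 : ℝ)) (mem_Ioi.2 hu) (mem_Ioi.2 hu') ha hb hab
  simp only [smul_eq_mul, zpow_neg_one, mem_Ioi] at hlogy hlogu hinv hpos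
  have hle : a * (x - r / y) + b * (x' - r / y') ≤
      a * x + b * x' - r / (a * y + b * y') := by
    have := mul_le_mul_of_nonneg_left hinv hr
    simp only [div_eq_mul_inv]
    linarith
  have := Real.log_le_log hpos hle
  rw [e, e', e'']
  linarith

theorem lt_mul_of_sqrt_lt {R x y : ℝ} (hx : √R < x) (hy : √R < y) : R < x * y := by
  have hs := Real.sqrt_nonneg R
  rcases le_or_gt 0 R with h | h
  · have := Real.mul_self_sqrt h
    nlinarith
  · exact h.trans (mul_pos (hs.trans_lt hx) (hs.trans_lt hy))

theorem multiset_prod_sub_pos {s : Multiset ℝ} {R t : ℝ} (hs : ∀ r ∈ s, r ≤ R) (ht : R < t) :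
    0 < (s.map (t - ·)).prod := by
  induction s using Multiset.induction_on with
  | empty => simp
  | cons a s ih =>
    simp only [Multiset.mem_cons, forall_eq_or_imp] at hs
    simpa using mul_pos (sub_pos.2 (hs.1.trans_lt ht)) (ih hs.2)

theorem concaveOn_log_multiset_prod {R : ℝ} {s : Multiset ℝ} (h0 : ∀ r ∈ s, 0 ≤ r)
    (hR : ∀ r ∈ s, r ≤ R) :
    ConcaveOn ℝ (Ioi √R ×ˢ Ioi √R)
      fun z : ℝ × ℝ => Real.log (s.map (z.1 * z.2 - ·)).prod := by
  induction s using Multiset.induction_on with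
  | empty => simpa using concaveOn_const 0 ((convex_Ioi _).prod (convex_Ioi _))
  | cons a s ih =>
    simp only [Multiset.mem_cons, forall_eq_or_imp] at h0 hR
    refine ((concaveOn_log_mul_sub h0.1 hR.1).add (ih h0.2 hR.2)).congr ?_
    rintro ⟨x, y⟩ ⟨hx, hy⟩
    have hxy := lt_mul_of_sqrt_lt hx hy
    simp only [Pi.add_apply, Multiset.map_cons, Multiset.prod_cons]
    rw [Real.log_mul (sub_pos.2 (hR.1.trans_lt hxy)).ne' (multiset_prod_sub_pos hR.2 hxy).ne']

/-- The Fuglede–Kadison potential is convex on `(√R, ∞)²`, and the product of its two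
partial derivatives on the diagonal recovers the rectangular Cauchy transform `H`. -/
theorem stmt9 (m d : ℕ) (hd : 1 ≤ d) (hdm : d ≤ m)
    (p : Polynomial ℝ) (hmonic : p.Monic) (hdeg : p.natDegree = d)
    (hsplit : p.roots.card = d) (hnonneg : ∀ r ∈ p.roots, 0 ≤ r)
    (R : ℝ) (hR : R ∈ p.roots) (hRmax : ∀ r ∈ p.roots, r ≤ R) :
    ConvexOn ℝ (Set.Ioi (Real.sqrt R) ×ˢ Set.Ioi (Real.sqrt R)) (Ffun m d p) ∧
      ∀ z : ℝ, Real.sqrt R < z →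
        deriv (fun x => Ffun m d p (x, z)) z * deriv (fun y => Ffun m d p (z, y)) z =
          Hfun m d p z := by
  have heval (t : ℝ) : p.eval t = (p.roots.map (t - ·)).prod := by
    conv_lhs => rw [← prod_multiset_X_sub_C_of_monic_of_roots_card_eq hmonic
      (hsplit.trans hdeg.symm)]
    simp [eval_multiset_prod, Multiset.map_map]
  have hp (t : ℝ) (ht : R < t) : 0 < p.eval t := by
    rw [heval]
    exact multiset_prod_sub_pos hRmax ht
  have hs := Real.sqrt_nonneg R
  constructor
  · have hy : ConcaveOn ℝ (Ioi √R ×ˢ Ioi √R) fun z : ℝ × ℝ => Real.log z.2 :=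
      (strictConcaveOn_log_Ioi.concaveOn.comp_linearMap (LinearMap.snd ℝ ℝ ℝ)).subset
        (fun z hz => hs.trans_lt hz.2) ((convex_Ioi _).prod (convex_Ioi _))
    have hF := (((hy.smul (Nat.cast_nonneg' (m - d))).add
      (concaveOn_log_multiset_prod hnonneg hRmax)).smul
        (one_div_nonneg.2 (Real.sqrt_nonneg ((m : ℝ) * d)))).neg
    refine hF.congr ?_
    rintro ⟨x, y⟩ ⟨hx, hy⟩
    have hy0 : 0 < y := hs.trans_lt hy
    have hxy := hp _ (lt_mul_of_sqrt_lt hx hy)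
    simp only [Ffun, Pi.neg_apply, Pi.add_apply, smul_eq_mul, ← heval]
    rw [Real.log_mul (pow_pos hy0 _).ne' hxy.ne', Real.log_pow]
    ring
  · intro z hz
    have hz0 : 0 < z := hs.trans_lt hz
    have hpz := hp _ (lt_mul_of_sqrt_lt hz hz)
    have hzk : 0 < z ^ (m - d) := pow_pos hz0 _
    have hd0 : (0 : ℝ) < d := by exact_mod_cast hd
    have hm0 : (0 : ℝ) < m := by exact_mod_cast hd.trans hdm
    have hx : HasDerivAt (fun x => Ffun m d p (x, z))
        (-(1 / √((m : ℝ) * d)) * (d * Gfun d p z)) z := by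
      have h := ((((p.hasDerivAt (z * z)).comp (h := fun x => x * z) z
        ((hasDerivAt_id z).mul_const z)).const_mul
        (z ^ (m - d))).log (mul_pos hzk hpz).ne').const_mul (-(1 / √((m : ℝ) * d)))
      refine h.congr_deriv ?_
      simp only [Gfun, Function.comp_apply, sq]
      field_simp
    have hy : HasDerivAt (fun y => Ffun m d p (z, y))
        (-(1 / √((m : ℝ) * d)) * ((m - d) / z + d * Gfun d p z)) z := by
      have h := (((hasDerivAt_pow (m - d) z).mul ((p.hasDerivAt (z * z)).comp
        (h := fun y => z * y) z ((hasDerivAt_id z).const_mul z))).log (mul_pos hzk hpz).ne').const_mul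
          (-(1 / √((m : ℝ) * d)))
      refine h.congr_deriv ?_
      have hk : ((m - d : ℕ) : ℝ) * z ^ (m - d - 1) = (m - d) / z * z ^ (m - d) := by
        rw [← Nat.cast_sub hdm]
        rcases Nat.eq_zero_or_pos (m - d) with h0 | h0
        · simp [h0]
        · rw [← mul_pow_sub_one h0.ne' z]
          field_simp
      simp only [Gfun, Function.comp_apply, sq, Pi.mul_apply, hk]
      generalize p.eval (z * z) = q at hpz ⊢
      field_simp
    rw [hx.deriv, hy.deriv, Hfun]
    have hsq := Real.sq_sqrt (mul_pos hm0 hd0).le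
    have hne := (Real.sqrt_pos.2 (mul_pos hm0 hd0)).ne'
    generalize Gfun d p z = g
    field_simp
    rw [hsq]
    ring
end
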